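/- Let d be a positive square-free integer with d ≡ 7 (mod 8), K = ℚ(√−d), and o_K its ring of integers. Let u = u₁ + u_i i + u_j j + u_k k ∈ ℍ(o_K) with N(u) = 1. Then u² = 2u₁u − 1, and u is a torsion unit (uⁿ = 1 for some n ≥ 1) if and only if u₁ ∈ {−1, 0, 1}; moreover, if u₁ = ±1 then u = ±1 (so u has order 1 or 2), and if u₁ = 0 then u² = −1, so u has order 4. -/

import Mathlib

open NumberField Module Quaternion

/-- `d m²` with `d ≡ 7 (mod 8)` and `m ≠ 0` is not a sum of three integer squares. -/
theorem Int.eq_zero_of_sum_three_sq_eq_mul_sq {d : ℤ} (hd7 : d % 8 = 7) (n : ℕ) :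
    ∀ x y z m : ℤ, m.natAbs = n → x ^ 2 + y ^ 2 + z ^ 2 = d * m ^ 2 → m = 0 := by
  induction n using Nat.strong_induction_on with
  | _ n ih =>
    intro x y z m hm h
    have sq_mod (t : ℤ) : (t % 2 = 0 ∧ t ^ 2 % 4 = 0) ∨ (t % 2 = 1 ∧ t ^ 2 % 8 = 1) := by
      rcases Int.even_or_odd' t with ⟨k, rfl | rfl⟩
      · left
        exact ⟨by omega, by ring_nf; omega⟩
      · right
        obtain ⟨l, hl⟩ := Int.even_mul_succ_self k
        refine ⟨by omega, ?_⟩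
        have : (2 * k + 1) ^ 2 = 8 * l + 1 := by linear_combination 4 * hl
        omega
    obtain ⟨e, rfl⟩ : ∃ e, d = 8 * e + 7 := ⟨d / 8, by omega⟩
    have h' : x ^ 2 + y ^ 2 + z ^ 2 = 8 * (e * m ^ 2) + 7 * m ^ 2 := by rw [h]; ring
    by_contra hm0
    have key : x % 2 = 0 ∧ y % 2 = 0 ∧ z % 2 = 0 ∧ m % 2 = 0 := by
      rcases sq_mod x with hx | hx <;> rcases sq_mod y with hy | hy <;>
        rcases sq_mod z with hz | hz <;> rcases sq_mod m with hm | hm <;> omega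
    obtain ⟨hx, hy, hz, hm2⟩ := key
    obtain ⟨x, rfl⟩ := Int.dvd_of_emod_eq_zero hx
    obtain ⟨y, rfl⟩ := Int.dvd_of_emod_eq_zero hy
    obtain ⟨z, rfl⟩ := Int.dvd_of_emod_eq_zero hz
    obtain ⟨m, rfl⟩ := Int.dvd_of_emod_eq_zero hm2
    have := ih m.natAbs (by omega) x y z m rfl (by linarith)
    omega

/-- Rational version of `Int.eq_zero_of_sum_three_sq_eq_mul_sq`. -/
theorem Rat.eq_zero_of_sum_three_sq_eq_mul_sq {d : ℤ} (hd7 : d % 8 = 7) {x y z m : ℚ}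
    (h : x ^ 2 + y ^ 2 + z ^ 2 = d * m ^ 2) : m = 0 := by
  have hx := Rat.mul_den_eq_num x
  have hy := Rat.mul_den_eq_num y
  have hz := Rat.mul_den_eq_num z
  have hm := Rat.mul_den_eq_num m
  have key := Int.eq_zero_of_sum_three_sq_eq_mul_sq hd7 _ (x.num * y.den * z.den * m.den)
    (y.num * x.den * z.den * m.den) (z.num * x.den * y.den * m.den)
    (m.num * x.den * y.den * z.den) rfl (by
      have : ((x.num * y.den * z.den * m.den) ^ 2 + (y.num * x.den * z.den * m.den) ^ 2 +
          (z.num * x.den * y.den * m.den) ^ 2 : ℚ) =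
          d * (m.num * x.den * y.den * z.den) ^ 2 := by
        rw [← hx, ← hy, ← hz, ← hm]
        linear_combination (x.den * y.den * z.den * m.den : ℚ) ^ 2 * h
      exact_mod_cast this)
  simpa using key

/-- Two orthogonal rational vectors with `|a|² = d |b|²`, `d ≡ 7 (mod 8)`, vanish. -/
theorem Rat.eq_zero_of_orthogonal_of_sum_sq_eq {d : ℤ} (hd7 : d % 8 = 7)
    {a₁ a₂ a₃ b₁ b₂ b₃ : ℚ} (h : a₁ ^ 2 + a₂ ^ 2 + a₃ ^ 2 = d * (b₁ ^ 2 + b₂ ^ 2 + b₃ ^ 2))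
    (ho : a₁ * b₁ + a₂ * b₂ + a₃ * b₃ = 0) :
    (a₁ = 0 ∧ a₂ = 0 ∧ a₃ = 0) ∧ b₁ = 0 ∧ b₂ = 0 ∧ b₃ = 0 := by
  have eq_zero {x y z : ℚ} (h : x ^ 2 + y ^ 2 + z ^ 2 = 0) : x = 0 ∧ y = 0 ∧ z = 0 := by
    refine ⟨?_, ?_, ?_⟩ <;> refine pow_eq_zero_iff two_ne_zero |>.mp ?_ <;>
      nlinarith [sq_nonneg x, sq_nonneg y, sq_nonneg z]
  have hb : b₁ ^ 2 + b₂ ^ 2 + b₃ ^ 2 = 0 :=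
    Rat.eq_zero_of_sum_three_sq_eq_mul_sq hd7 (x := a₁ * b₂ - a₂ * b₁)
      (y := a₂ * b₃ - a₃ * b₂) (z := a₃ * b₁ - a₁ * b₃) (by
        linear_combination (b₁ ^ 2 + b₂ ^ 2 + b₃ ^ 2) * h -
          (a₁ * b₁ + a₂ * b₂ + a₃ * b₃) * ho)
  rw [hb, mul_zero] at h
  exact ⟨eq_zero h, eq_zero hb⟩

section Quadratic

variable {K : Type*} [Field K] [CharZero K]

/-- A square root of a negative integer is rationally independent of `1`. -/
theorem eq_zero_and_eq_zero_of_add_mul_sqrt_neg {d : ℤ} (hd : 0 < d) {α : K}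
    (hα : α ^ 2 = -(d : K)) {p q : ℚ} (h : (p : K) + q * α = 0) : p = 0 ∧ q = 0 := by
  have h1 : ((p ^ 2 + d * q ^ 2 : ℚ) : K) = 0 := by
    push_cast
    linear_combination (p - q * α) * h + q ^ 2 * hα
  have h2 : p ^ 2 + d * q ^ 2 = 0 := by exact_mod_cast h1
  have hd' : (0 : ℚ) < d := by exact_mod_cast hd
  have hq : q ^ 2 = 0 := by nlinarith [sq_nonneg p, sq_nonneg q]
  have hp : p ^ 2 = 0 := by rw [hq] at h2; linarith
  exact ⟨by simpa using hp, by simpa using hq⟩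

/-- In a quadratic field, every element is a rational combination of `1` and `√-d`. -/
theorem exists_rat_add_mul_sqrt_neg (hK : finrank ℚ K = 2) {d : ℤ} (hd : 0 < d) {α : K}
    (hα : α ^ 2 = -(d : K)) (x : K) : ∃ p q : ℚ, x = p + q * α := by
  have hli : LinearIndependent ℚ ![(1 : K), α] := by
    rw [LinearIndependent.pair_iff]
    intro s t hst
    refine eq_zero_and_eq_zero_of_add_mul_sqrt_neg hd hα ?_
    simpa [Rat.smul_def] using hst
  have hspan := hli.span_eq_top_of_card_eq_finrank (by simp [hK])
  have hx : x ∈ Submodule.span ℚ (Set.range ![(1 : K), α]) := hspan ▸ Submodule.mem_top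
  rw [Matrix.range_cons, Matrix.range_cons, Matrix.range_empty, Set.union_empty,
    Set.singleton_union, Submodule.mem_span_pair] at hx
  obtain ⟨p, q, h⟩ := hx
  exact ⟨p, q, by simpa [Rat.smul_def] using h.symm⟩

/-- Sums of three squares are anisotropic over `ℚ(√-d)` when `d ≡ 7 (mod 8)`. -/
theorem eq_zero_of_sum_three_sq_eq_zero (hK : finrank ℚ K = 2) {d : ℤ} (hd : 0 < d)
    (hd7 : d % 8 = 7) {α : K} (hα : α ^ 2 = -(d : K)) {x y z : K}
    (h : x ^ 2 + y ^ 2 + z ^ 2 = 0) : x = 0 ∧ y = 0 ∧ z = 0 := by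
  obtain ⟨a₁, b₁, rfl⟩ := exists_rat_add_mul_sqrt_neg hK hd hα x
  obtain ⟨a₂, b₂, rfl⟩ := exists_rat_add_mul_sqrt_neg hK hd hα y
  obtain ⟨a₃, b₃, rfl⟩ := exists_rat_add_mul_sqrt_neg hK hd hα z
  obtain ⟨h1, h2⟩ := eq_zero_and_eq_zero_of_add_mul_sqrt_neg hd hα
    (p := a₁ ^ 2 + a₂ ^ 2 + a₃ ^ 2 - d * (b₁ ^ 2 + b₂ ^ 2 + b₃ ^ 2))
    (q := 2 * (a₁ * b₁ + a₂ * b₂ + a₃ * b₃)) (by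
      push_cast
      linear_combination h - ((b₁ : K) ^ 2 + b₂ ^ 2 + b₃ ^ 2) * hα)
  obtain ⟨⟨rfl, rfl, rfl⟩, rfl, rfl, rfl⟩ :=
    Rat.eq_zero_of_orthogonal_of_sum_sq_eq hd7 (sub_eq_zero.mp h1) (by linarith)
  simp

end Quadratic

section Torsion

variable {R : Type*} [CommRing R]

/-- The characteristic equation of a quaternion of norm one. -/
theorem Quaternion.sq_eq_two_mul_re_mul_sub_one {u : ℍ[R]} (hu : normSq u = 1) :
    u ^ 2 = 2 * (u.re : ℍ[R]) * u - 1 := by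
  have h1 : u * star u = 1 := by rw [self_mul_star, hu]; simp
  have h2 : star u = 2 * (u.re : ℍ[R]) - u := eq_sub_of_add_eq' (self_add_star u)
  have hc : u * (2 * (u.re : ℍ[R])) = 2 * (u.re : ℍ[R]) * u := by
    rw [two_mul, mul_add, add_mul, coe_commutes]
  rw [h2, mul_sub, hc, ← sq] at h1
  rw [← h1, sub_sub_cancel]

/-- Powers of a norm one quaternion reduce to linear expressions, in the same way as powers of
complex roots of its characteristic polynomial. -/
theorem Quaternion.exists_pow_eq_mul_add {u : ℍ[R]} (hu : normSq u = 1) (n : ℕ) :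
    ∃ a b : R, u ^ n = (a : ℍ[R]) * u + (b : ℍ[R]) ∧
      ∀ (σ : R →+* ℂ) (ζ : ℂ), ζ ^ 2 = 2 * σ u.re * ζ - 1 → ζ ^ n = σ a * ζ + σ b := by
  induction n with
  | zero => exact ⟨0, 1, by simp, by simp⟩
  | succ n ih =>
    obtain ⟨a, b, h, hζ⟩ := ih
    refine ⟨u.re * a + u.re * a + b, -a, ?_, fun σ ζ hσ => ?_⟩
    · have h2 := sq_eq_two_mul_re_mul_sub_one hu
      have hc := coe_commutes a (2 * (u.re : ℍ[R]))
      rw [pow_succ, h, add_mul, mul_assoc, ← sq, h2, mul_sub, ← mul_assoc, hc]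
      push_cast
      noncomm_ring
    · rw [pow_succ, hζ σ ζ hσ]
      simp only [map_add, map_mul, map_neg]
      linear_combination σ a * hσ

/-- The real part of a non-central torsion quaternion of norm one becomes a real number in
`[-1, 1]` under every complex embedding. -/
theorem Quaternion.exists_real_of_pow_eq_one [IsDomain R] {u : ℍ[R]} (hu : normSq u = 1)
    (him : u.im ≠ 0) {n : ℕ} (hn : n ≠ 0) (h : u ^ n = 1) (σ : R →+* ℂ) :
    ∃ r : ℝ, σ u.re = r ∧ |r| ≤ 1 := by
  obtain ⟨a, b, hab, hζ⟩ := exists_pow_eq_mul_add hu n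
  rw [h] at hab
  have ha : a = 0 := by
    by_contra ha
    apply him
    have h1 := congrArg QuaternionAlgebra.imI hab
    have h2 := congrArg QuaternionAlgebra.imJ hab
    have h3 := congrArg QuaternionAlgebra.imK hab
    simp [ha] at h1 h2 h3
    ext <;> simp [h1, h2, h3]
  subst ha
  have hb : 1 = b := by simpa using congrArg QuaternionAlgebra.re hab
  subst hb
  obtain ⟨s, hs⟩ := IsAlgClosed.exists_pow_nat_eq (σ u.re ^ 2 - 1) two_pos
  set ζ := σ u.re + s with hζdef
  have hq : ζ ^ 2 = 2 * σ u.re * ζ - 1 := by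
    rw [hζdef]; linear_combination hs
  have hpow : ζ ^ n = 1 := by simpa using hζ σ ζ hq
  have hnorm : ‖ζ‖ = 1 := Complex.norm_eq_one_of_pow_eq_one hpow hn
  have hconj : ζ * (starRingEnd ℂ) ζ = 1 := by
    rw [Complex.mul_conj, Complex.normSq_eq_norm_sq, hnorm]; simp
  have hζ0 : ζ ≠ 0 := by rintro h0; simp [h0] at hnorm
  refine ⟨ζ.re, ?_, hnorm ▸ Complex.abs_re_le_norm ζ⟩
  have h2 : ζ + (starRingEnd ℂ) ζ = 2 * (ζ.re : ℂ) := by rw [Complex.add_conj]; push_cast; ring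
  have : ζ * (2 * (σ u.re - ζ.re)) = 0 := by
    linear_combination ζ * h2 - hq - hconj
  simpa [hζ0, sub_eq_zero] using this

end Torsion

/-- A norm one torsion quaternion over the ring of integers of a number field has real part
`-1`, `0` or `1`. -/
theorem Quaternion.re_of_pow_eq_one {K : Type*} [Field K] [NumberField K] {u : ℍ[𝓞 K]}
    (hu : normSq u = 1) {n : ℕ} (hn : n ≠ 0) (h : u ^ n = 1) :
    u.re = -1 ∨ u.re = 0 ∨ u.re = 1 := by
  by_cases him : u.im = 0
  · have h1 : u.imI = 0 := by simpa using congrArg QuaternionAlgebra.imI him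
    have h2 : u.imJ = 0 := by simpa using congrArg QuaternionAlgebra.imJ him
    have h3 : u.imK = 0 := by simpa using congrArg QuaternionAlgebra.imK him
    rw [normSq_def', h1, h2, h3] at hu
    have : u.re = 1 ∨ u.re = -1 := by simpa using hu
    tauto
  · have key (φ : K →+* ℂ) : ∃ r : ℝ, φ u.re = r ∧ |r| ≤ 1 :=
      exists_real_of_pow_eq_one hu him hn h (φ.comp (algebraMap (𝓞 K) K))
    by_cases h0 : u.re = 0
    · exact .inr (.inl h0)
    obtain ⟨m, hm, hpow⟩ := NumberField.Embeddings.pow_eq_one_of_norm_le_one K ℂ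
      (x := (u.re : K)) (by simpa using h0) (RingOfIntegers.isIntegral_coe u.re) fun φ => by
        obtain ⟨r, hr, hr1⟩ := key φ
        simpa [hr] using hr1
    obtain ⟨φ⟩ : Nonempty (K →+* ℂ) := inferInstance
    obtain ⟨r, hr, -⟩ := key φ
    have hrm : r ^ m = 1 := by
      have := congrArg φ hpow
      rw [map_pow, hr, map_one] at this
      exact_mod_cast this
    have hr2 : r ^ 2 = 1 := by
      rw [← sq_abs, (pow_eq_one_iff_of_nonneg (abs_nonneg r) hm.ne').mp (by
        rw [← abs_pow, hrm, abs_one]), one_pow]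
    have hφ : φ ((u.re : K) ^ 2) = φ 1 := by
      rw [map_pow, hr, map_one]
      exact_mod_cast hr2
    have hsq : u.re ^ 2 = 1 := RingOfIntegers.ext (by simpa using φ.injective hφ)
    have : u.re = 1 ∨ u.re = -1 := by simpa using hsq
    tauto

/-- Let `d > 0` be square-free with `d ≡ 7 (mod 8)`, `K = ℚ(√−d)`, and
`𝓞 K` its ring of integers.  Let `u ∈ ℍ(𝓞 K)` with `N(u) = 1`.  Then
`u² = 2u₁u − 1`, and `u` is a torsion unit if and only if `u₁ ∈ {−1, 0, 1}`; moreover,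
if `u₁ = ±1` then `u = ±1` (order 1 or 2), and if `u₁ = 0` then `u² = −1` (order 4). -/
theorem stmt13 (d : ℤ) (hd : Squarefree d) (hdpos : 0 < d) (hd7 : d % 8 = 7)
    (K : Type*) [Field K] [NumberField K] (hK : finrank ℚ K = 2)
    (α : 𝓞 K) (hα : α ^ 2 = -(d : 𝓞 K))
    (u : ℍ[𝓞 K]) (hu : Quaternion.normSq u = 1) :
    u ^ 2 = 2 * (u.re : ℍ[𝓞 K]) * u - 1 ∧
    ((∃ n : ℕ, 1 ≤ n ∧ u ^ n = 1) ↔ (u.re = -1 ∨ u.re = 0 ∨ u.re = 1)) ∧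
    (u.re = 1 → u = 1) ∧ (u.re = -1 → u = -1) ∧ (u.re = 0 → u ^ 2 = -1) := by
  have hsq := Quaternion.sq_eq_two_mul_re_mul_sub_one hu
  have him (h : u.re ^ 2 = 1) : u.imI = 0 ∧ u.imJ = 0 ∧ u.imK = 0 := by
    rw [Quaternion.normSq_def', h] at hu
    have hα' : (α : K) ^ 2 = -(d : K) := by
      simpa using congrArg (algebraMap (𝓞 K) K) hα
    have hsum : (u.imI : K) ^ 2 + (u.imJ : K) ^ 2 + (u.imK : K) ^ 2 = 0 := by
      have := congrArg (algebraMap (𝓞 K) K) hu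
      simp only [map_add, map_pow, map_one] at this
      linear_combination this
    simpa using eq_zero_of_sum_three_sq_eq_zero hK hdpos hd7 hα' hsum
  have hone (h : u.re = 1) : u = 1 := by
    obtain ⟨h1, h2, h3⟩ := him (by simp [h])
    ext <;> simp [h, h1, h2, h3]
  have hneg (h : u.re = -1) : u = -1 := by
    obtain ⟨h1, h2, h3⟩ := him (by simp [h])
    ext <;> simp [h, h1, h2, h3]
  have hzero (h : u.re = 0) : u ^ 2 = -1 := by rw [hsq, h]; simp
  refine ⟨hsq, ⟨?_, ?_⟩, hone, hneg, hzero⟩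
  · rintro ⟨n, hn, h⟩
    exact Quaternion.re_of_pow_eq_one hu (by omega) h
  · rintro (h | h | h)
    · exact ⟨2, by norm_num, by rw [hneg h]; simp⟩
    · exact ⟨4, by norm_num, by rw [show 4 = 2 * 2 from rfl, pow_mul, hzero h]; simp⟩
    · exact ⟨1, le_rfl, by rw [hone h]; simp⟩
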